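/- Let μ be an orthogonal partition of the even number 2m, and let k > 0 be odd with μ_k ≥ μ_{k+1} + 2. Define ν by ν_j = μ_j − 2 for j ≤ k and ν_j = μ_j for j > k. Then ν is an orthogonal partition of 2(m−k); if μ is special then ν is special; and if σ is a D-collapse of ν^t and τ is a D-collapse of μ^t, then τ = σ ∪ (k,k). -/

import Mathlib

/-- `f` is a partition of `d`: weakly decreasing, finitely many nonzero terms, total sum `d`.
    Indexing is 0-based: `f j` is the `(j+1)`-st part. -/
def IsPartitionOf (f : ℕ → ℕ) (d : ℕ) : Prop :=
  Antitone f ∧ ∃ N, (∀ j, N ≤ j → f j = 0) ∧ ∑ j ∈ Finset.range N, f j = d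

/-- Transpose of a partition (0-based): `ptrans f k` = #{j : f j ≥ k+1}, i.e. `(f^t)_{k+1}`. -/
noncomputable def ptrans (f : ℕ → ℕ) : ℕ → ℕ := fun k => Nat.card {j : ℕ // k + 1 ≤ f j}

/-- Multiplicity of the part `k` in `f` (meaningful for `k > 0`). -/
noncomputable def pmult (f : ℕ → ℕ) (k : ℕ) : ℕ := Nat.card {j : ℕ // f j = k}

/-- Orthogonal: every even positive part occurs with even multiplicity. -/
def IsOrthogonal (f : ℕ → ℕ) : Prop := ∀ k, 0 < k → Even k → Even (pmult f k)

/-- Symplectic: every odd positive part occurs with even multiplicity. -/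
def IsSymplectic (f : ℕ → ℕ) : Prop := ∀ k, 0 < k → Odd k → Even (pmult f k)

/-- Dominance order for ℕ-valued sequences. -/
def NDomLE (f g : ℕ → ℕ) : Prop :=
  ∀ N, ∑ j ∈ Finset.range N, f j ≤ ∑ j ∈ Finset.range N, g j

/-- Dominance order for ℤ-valued sequences. -/
def DomLE (f g : ℕ → ℤ) : Prop :=
  ∀ N, ∑ j ∈ Finset.range N, f j ≤ ∑ j ∈ Finset.range N, g j

/-- `ν` is the `P`-collapse of `μ` (both of total size `m`): `ν` is a partition of `m`
    satisfying `P`, `ν ≤ μ`, and every partition `σ` of `m` satisfying `P` with `σ ≤ μ`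
    satisfies `σ ≤ ν`. -/
def IsCollapse (P : (ℕ → ℕ) → Prop) (m : ℕ) (μ ν : ℕ → ℕ) : Prop :=
  IsPartitionOf ν m ∧ P ν ∧ NDomLE ν μ ∧
    ∀ σ, IsPartitionOf σ m → P σ → NDomLE σ μ → NDomLE σ ν

/-- B-collapse (largest orthogonal partition below `μ`, `m` odd). -/
def IsBCollapse : ℕ → (ℕ → ℕ) → (ℕ → ℕ) → Prop := IsCollapse IsOrthogonal
/-- C-collapse (largest symplectic partition below `μ`, `m` even). -/
def IsCCollapse : ℕ → (ℕ → ℕ) → (ℕ → ℕ) → Prop := IsCollapse IsSymplectic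
/-- D-collapse (largest orthogonal partition below `μ`, `m` even). -/
def IsDCollapse : ℕ → (ℕ → ℕ) → (ℕ → ℕ) → Prop := IsCollapse IsOrthogonal

/-- `μ^−` : decrease the smallest nonzero part by 1. -/
def minusOne (f : ℕ → ℕ) : ℕ → ℕ :=
  fun j => if 0 < f j ∧ f (j+1) = 0 then f j - 1 else f j

/-- `μ^+` : increase the largest part by 1. -/
def plusOne (f : ℕ → ℕ) : ℕ → ℕ := fun j => if j = 0 then f 0 + 1 else f j

/-- `u = f ∪ g` : `u` is weakly decreasing, finitely supported, and every positive
    part occurs in `u` with multiplicity the sum of its multiplicities in `f` and `g`. -/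
def IsUnionOf (u f g : ℕ → ℕ) : Prop :=
  Antitone u ∧ (∃ N, ∀ j, N ≤ j → u j = 0) ∧
    ∀ k, 0 < k → pmult u k = pmult f k + pmult g k

/-- The sequence ξ attached to `(f, g, ε₁, ε₂, d)`.  Index `j` here corresponds to the
    1-based index `j+1` of the paper. -/
def xiSeq (f g : ℕ → ℕ) (e1 e2 d : ℕ) : ℕ → ℤ := fun j =>
  if (j + 1) % 2 = (d + 1) % 2 ∧ f j % 2 = e1 ∧ g j % 2 = e2 ∧
      (j = 0 ∨ f j + g j < f (j - 1) + g (j - 1)) then 1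
  else if (j + 1) % 2 = d % 2 ∧ f j % 2 = e1 ∧ g j % 2 = e2 ∧
      f (j + 1) + g (j + 1) < f j + g j then -1
  else 0

/-- The Waldspurger sequence `W(f,g) = f + g + ξ` (ℤ-valued a priori). -/
def wald (f g : ℕ → ℕ) (e1 e2 d : ℕ) : ℕ → ℤ :=
  fun j => (f j : ℤ) + (g j : ℤ) + xiSeq f g e1 e2 d j

/-- Decrease the first `k` parts of `μ` by 2. -/
def stripTwo (μ : ℕ → ℕ) (k : ℕ) : ℕ → ℕ := fun j => if j < k then μ j - 2 else μ j

/-- The partition `(k,k)` with two parts equal to `k`. -/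
def twoParts (k : ℕ) : ℕ → ℕ := fun j => if j < 2 then k else 0

/-- Partial sums of a sequence. -/
def partSum (f : ℕ → ℕ) (n : ℕ) : ℕ := ∑ i ∈ Finset.range n, f i

@[simp] lemma partSum_zero (f : ℕ → ℕ) : partSum f 0 = 0 := by simp [partSum]

lemma partSum_succ (f : ℕ → ℕ) (n : ℕ) : partSum f (n + 1) = partSum f n + f n := by
  simp [partSum, Finset.sum_range_succ]

lemma partSum_injective : Function.Injective partSum := by
  intro f g h
  funext n
  have h₁ := congrFun h n
  have h₂ := congrFun h (n + 1)
  rw [partSum_succ, partSum_succ] at h₂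
  omega

lemma partSum_eq_of_isPartitionOf {f : ℕ → ℕ} {d : ℕ} (hf : IsPartitionOf f d) :
    ∃ N, (∀ j, N ≤ j → f j = 0) ∧ ∀ j, N ≤ j → partSum f j = d := by
  obtain ⟨-, N, hN, hs⟩ := hf
  refine ⟨N, hN, fun j hj => ?_⟩
  induction j, hj using Nat.le_induction with
  | base => exact hs
  | succ j hj ih => rw [partSum_succ, ih, hN j hj, add_zero]

lemma lt_natCard_iff {s : ℕ → Prop} (hs : ∀ i j, i ≤ j → s j → s i) (hfin : ∃ N, ¬ s N) (j : ℕ) :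
    j < Nat.card {j : ℕ // s j} ↔ s j := by
  classical
  have key : ∀ j, s j ↔ j < Nat.find hfin := by
    intro j
    constructor
    · intro h
      by_contra! hle
      exact Nat.find_spec hfin (hs _ _ hle h)
    · intro h
      simpa using Nat.find_min hfin h
  have hcard : Nat.card {j : ℕ // s j} = Nat.find hfin := by
    rw [Nat.card_congr (Equiv.subtypeEquivRight key)]
    exact (Nat.card_congr Fin.equivSubtype.symm).trans (by simp)
  rw [hcard, key]

lemma lt_ptrans_iff {f : ℕ → ℕ} (hf : Antitone f) {N : ℕ} (hN : ∀ j, N ≤ j → f j = 0) (j v : ℕ) :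
    j < ptrans f v ↔ v < f j :=
  lt_natCard_iff (s := fun j => v + 1 ≤ f j) (fun _ _ hij h => h.trans (hf hij))
    ⟨N, by simp [hN N le_rfl]⟩ j

lemma ptrans_antitone {f : ℕ → ℕ} (hf : Antitone f) {N : ℕ} (hN : ∀ j, N ≤ j → f j = 0) :
    Antitone (ptrans f) := by
  intro a b hab
  by_contra! h
  have h₁ := (lt_ptrans_iff hf hN _ _).1 h
  have h₂ := mt (lt_ptrans_iff hf hN (ptrans f a) a).2 (lt_irrefl _)
  omega

lemma ptrans_eq_zero {f : ℕ → ℕ} (hf : Antitone f) {N : ℕ} (hN : ∀ j, N ≤ j → f j = 0)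
    {j : ℕ} (hj : f 0 ≤ j) : ptrans f j = 0 := by
  have h := mt (lt_ptrans_iff hf hN 0 j).1 (by omega)
  omega

lemma ptrans_ptrans {f : ℕ → ℕ} (hf : Antitone f) {N : ℕ} (hN : ∀ j, N ≤ j → f j = 0) :
    ptrans (ptrans f) = f := by
  funext k
  have h : ∀ i, i < ptrans (ptrans f) k ↔ i < f k := fun i =>
    (lt_ptrans_iff (ptrans_antitone hf hN) (fun j => ptrans_eq_zero hf hN) i k).trans
      (lt_ptrans_iff hf hN k i)
  have h₁ := h (f k)
  have h₂ := h (ptrans (ptrans f) k)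
  omega

lemma pmult_eq_sum {f : ℕ → ℕ} {N : ℕ} (hN : ∀ j, N ≤ j → f j = 0) {v : ℕ} (hv : 0 < v) :
    pmult f v = ∑ i ∈ Finset.range N, if f i = v then 1 else 0 := by
  have hset : ∀ j, f j = v ↔ j ∈ (Finset.range N).filter (f · = v) := by
    intro j
    simp only [Finset.mem_filter, Finset.mem_range]
    refine ⟨fun h => ⟨?_, h⟩, fun h => h.2⟩
    by_contra! hj
    rw [hN j hj] at h
    omega
  rw [← Finset.card_filter, pmult, Nat.card_congr (Equiv.subtypeEquivRight hset),
    Nat.card_eq_fintype_card, Fintype.card_coe]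

lemma pmult_succ {f : ℕ → ℕ} (hf : Antitone f) {N : ℕ} (hN : ∀ j, N ≤ j → f j = 0) (v : ℕ) :
    pmult f (v + 1) + ptrans f (v + 1) = ptrans f v := by
  have hle := ptrans_antitone hf hN (Nat.le_add_right v 1)
  have hset : ∀ j, f j = v + 1 ↔ j ∈ Finset.Ico (ptrans f (v + 1)) (ptrans f v) := by
    intro j
    rw [Finset.mem_Ico, ← not_lt, lt_ptrans_iff hf hN, lt_ptrans_iff hf hN]
    omega
  have hcard : pmult f (v + 1) = ptrans f v - ptrans f (v + 1) := by
    rw [pmult, Nat.card_congr (Equiv.subtypeEquivRight hset), Nat.card_eq_fintype_card,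
      Fintype.card_coe, Nat.card_Ico]
  omega

lemma pmult_ptrans {f : ℕ → ℕ} (hf : Antitone f) {N : ℕ} (hN : ∀ j, N ≤ j → f j = 0) (v : ℕ) :
    pmult (ptrans f) (v + 1) + f (v + 1) = f v := by
  have h := pmult_succ (ptrans_antitone hf hN) (fun j => ptrans_eq_zero hf hN) v
  rwa [ptrans_ptrans hf hN] at h

lemma IsPartitionOf.ptrans {f : ℕ → ℕ} {d : ℕ} (hf : IsPartitionOf f d) :
    IsPartitionOf (ptrans f) d := by
  obtain ⟨ha, N, hN, hs⟩ := hf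
  refine ⟨ptrans_antitone ha hN, f 0, fun j => ptrans_eq_zero ha hN, ?_⟩
  have h₁ : ∀ v, _root_.ptrans f v = ∑ j ∈ Finset.range N, if v < f j then 1 else 0 := by
    intro v
    rw [← Finset.card_filter, ← Finset.card_range (_root_.ptrans f v)]
    congr 1
    ext j
    simp only [Finset.mem_range, Finset.mem_filter, lt_ptrans_iff ha hN]
    refine ⟨fun h => ⟨?_, h⟩, fun h => h.2⟩
    by_contra! hj
    simp [hN j hj] at h
  simp_rw [h₁]
  rw [Finset.sum_comm, ← hs]
  refine Finset.sum_congr rfl fun j _ => ?_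
  rw [← Finset.card_filter, ← Finset.card_range (f j)]
  congr 1
  ext v
  have := ha (Nat.zero_le j)
  simp only [Finset.mem_filter, Finset.mem_range, Finset.card_range]
  omega

/-- The partial sum up to the last part exceeding `v` splits off the block of parts `v + 1`. -/
lemma partSum_ptrans_succ {f : ℕ → ℕ} (hf : Antitone f) {N : ℕ} (hN : ∀ j, N ≤ j → f j = 0)
    (v : ℕ) : partSum f (ptrans f v) =
      partSum f (ptrans f (v + 1)) + pmult f (v + 1) * (v + 1) := by
  have h : ∀ c, c ≤ pmult f (v + 1) →
      partSum f (ptrans f (v + 1) + c) = partSum f (ptrans f (v + 1)) + c * (v + 1) := by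
    have hm := pmult_succ hf hN v
    intro c
    induction c with
    | zero => simp
    | succ c ih =>
      intro hc
      have h₁ := lt_ptrans_iff hf hN (ptrans f (v + 1) + c) (v + 1)
      have h₂ := lt_ptrans_iff hf hN (ptrans f (v + 1) + c) v
      have h₃ : f (ptrans f (v + 1) + c) = v + 1 := by omega
      rw [← add_assoc, partSum_succ, ih (by omega), h₃]
      ring
  rw [← h _ le_rfl, ← pmult_succ hf hN v, add_comm]

/-- A partition is orthogonal iff the sum of its first `n + 1` parts has the parity of `n + 1`
whenever the `n`-th part (counting from zero) is the last of its value. -/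
lemma isOrthogonal_iff {f : ℕ → ℕ} (hf : Antitone f) {N : ℕ} (hN : ∀ j, N ≤ j → f j = 0) :
    IsOrthogonal f ↔ ∀ n, f (n + 1) < f n → Even (partSum f (n + 1) + (n + 1)) := by
  constructor
  · intro ho
    have key : ∀ c v, f 0 ≤ v + c → Even (partSum f (ptrans f v) + ptrans f v) := by
      intro c
      induction c with
      | zero =>
        intro v hv
        simp [ptrans_eq_zero hf hN (j := v) hv]
      | succ c ih =>
        intro v hv
        have h₁ := ih (v + 1) (by omega)
        have h₂ := ho (v + 1) v.succ_pos
        rw [partSum_ptrans_succ hf hN, ← pmult_succ hf hN v]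
        simp only [Nat.even_add, Nat.even_mul] at h₁ h₂ ⊢
        tauto
    intro n hn
    have h₁ := lt_ptrans_iff hf hN n (f n - 1)
    have h₂ := lt_ptrans_iff hf hN (n + 1) (f n - 1)
    have h₃ : ptrans f (f n - 1) = n + 1 := by omega
    rw [← h₃]
    exact key (f 0) _ (by omega)
  · intro h
    have key : ∀ v, Even (partSum f (ptrans f v) + ptrans f v) := by
      intro v
      rcases hn : ptrans f v with _ | n
      · simp
      · have h₁ := lt_ptrans_iff hf hN n v
        have h₂ := lt_ptrans_iff hf hN (n + 1) v
        exact h n (by omega)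
    intro k hk hke
    obtain ⟨v, rfl⟩ := Nat.exists_eq_succ_of_ne_zero hk.ne'
    have h₁ := key v
    have h₂ := key (v + 1)
    rw [partSum_ptrans_succ hf hN, ← pmult_succ hf hN v] at h₁
    simp only [Nat.succ_eq_add_one, Nat.even_add, Nat.even_mul] at h₁ h₂ hke ⊢
    tauto

/-- The amount (`0` or `1`) by which the orthogonal collapse lowers the `n`-th partial sum. -/
def defect (f : ℕ → ℕ) (n : ℕ) : ℕ :=
  if (partSum f n + n) % 2 = 1 ∧ ¬(f (n - 1) = f n ∧ f n % 2 = 0) then 1 else 0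

@[simp] lemma defect_zero (f : ℕ → ℕ) : defect f 0 = 0 := by simp [defect]

/-- The orthogonal collapse of a partition, given by an explicit formula. -/
def orthCollapse (f : ℕ → ℕ) (n : ℕ) : ℕ := f n + defect f n - defect f (n + 1)

lemma defect_succ (f : ℕ → ℕ) (n : ℕ) : defect f (n + 1) =
    if (partSum f n + f n + n + 1) % 2 = 1 ∧ ¬(f n = f (n + 1) ∧ f (n + 1) % 2 = 0)
      then 1 else 0 := by
  simp [defect, partSum_succ, add_assoc]

lemma defect_succ_le {f : ℕ → ℕ} (hf : Antitone f) (n : ℕ) :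
    defect f (n + 1) ≤ f n + defect f n := by
  have := hf (Nat.le_add_right n 1)
  rw [defect_succ]
  split_ifs <;> omega

lemma partSum_orthCollapse {f : ℕ → ℕ} (hf : Antitone f) (n : ℕ) :
    partSum (orthCollapse f) n + defect f n = partSum f n := by
  induction n with
  | zero => simp
  | succ n ih =>
    have := defect_succ_le hf n
    rw [partSum_succ, partSum_succ, orthCollapse]
    omega

lemma defect_of_odd_of_bad {f : ℕ → ℕ} {n : ℕ} (h : (partSum f n + n) % 2 = 1)
    (ho : f n % 2 = 1 ∨ f (n - 1) % 2 = 1) : defect f n = 1 := by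
  rw [defect, if_pos]
  omega

lemma defect_of_good {f : ℕ → ℕ} {n : ℕ} (h : (partSum f n + n) % 2 = 0) : defect f n = 0 := by
  rw [defect, if_neg]
  omega

lemma orthCollapse_antitone {f : ℕ → ℕ} (hf : Antitone f) : Antitone (orthCollapse f) := by
  refine antitone_nat_of_succ_le fun n => ?_
  have h₁ := hf (Nat.le_add_right n 1)
  have h₃ := defect_succ_le hf n
  have hs := defect_succ f n
  have ht := defect_succ f (n + 1)
  have hb := @defect_of_odd_of_bad f n
  rw [partSum_succ] at ht
  unfold orthCollapse
  split_ifs at hs ht <;> omega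

lemma orthCollapse_isCollapse {f : ℕ → ℕ} {d : ℕ} (hf : IsPartitionOf f d) :
    IsCollapse IsOrthogonal d f (orthCollapse f) := by
  obtain ⟨N, hN, hd⟩ := partSum_eq_of_isPartitionOf hf
  have ha := hf.1
  have hz : ∀ n, N < n → defect f n = 0 := by
    intro n hn
    rw [defect, if_neg]
    rw [hN n (by omega), hN (n - 1) (by omega)]
    simp
  have hN' : ∀ n, N + 1 ≤ n → orthCollapse f n = 0 := by
    intro n hn
    rw [orthCollapse, hN n (by omega), hz n (by omega)]
    simp
  have hca := orthCollapse_antitone ha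
  have hps := partSum_orthCollapse ha
  refine ⟨⟨hca, N + 1, hN', ?_⟩, ?_, fun n => ?_, ?_⟩
  · have h := hps (N + 1)
    rw [hz _ (by omega), hd _ (by omega)] at h
    exact h
  · rw [isOrthogonal_iff hca hN']
    intro n hn
    by_contra hodd
    have h₁ := hps (n + 1)
    have h₂ := defect_succ f n
    have h₃ := @defect_of_good f n
    have h₄ := @defect_of_good f (n + 1 + 1)
    have h₅ := partSum_succ f n
    have h₆ := partSum_succ f (n + 1)
    rw [Nat.even_iff] at hodd
    unfold orthCollapse at hn
    split_ifs at h₂ <;> omega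
  · have := hps n
    simp only [partSum] at this
    omega
  · intro σ hσ hσo hle
    obtain ⟨M, hM, -⟩ := partSum_eq_of_isPartitionOf hσ
    rw [isOrthogonal_iff hσ.1 hM] at hσo
    have hle' : ∀ n, partSum σ n ≤ partSum f n := hle
    have key : ∀ n, defect f n = 1 → partSum σ n ≠ partSum f n := by
      intro n
      induction n with
      | zero => simp
      | succ n ih =>
        intro hdef heq
        have h₁ := defect_succ f n
        have h₂ := hσo n
        have h₃ := hσ.1 (Nat.le_add_right n 1)
        have h₄ := hle' n
        have h₅ := hle' (n + 1 + 1)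
        have h₆ := @defect_of_odd_of_bad f n
        have h₇ := ha (Nat.le_add_right n 1)
        rw [Nat.even_iff] at h₂
        rw [partSum_succ σ (n + 1), partSum_succ f (n + 1)] at h₅
        rw [partSum_succ σ n, partSum_succ f n] at *
        split_ifs at h₁ <;> omega
    intro n
    change partSum σ n ≤ partSum (orthCollapse f) n
    have h₁ := hps n
    have h₂ := hle' n
    have h₃ := key n
    have h₄ : defect f n ≤ 1 := by unfold defect; split_ifs <;> omega
    omega

lemma IsCollapse.unique {P : (ℕ → ℕ) → Prop} {d : ℕ} {f g h : ℕ → ℕ}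
    (hg : IsCollapse P d f g) (hh : IsCollapse P d f h) : g = h :=
  partSum_injective <| funext fun n =>
    le_antisymm (hh.2.2.2 g hg.1 hg.2.1 hg.2.2.1 n) (hg.2.2.2 h hh.1 hh.2.1 hh.2.2.1 n)

/-- Insert two entries `k` into a sequence before position `p`. -/
def insertTwo (f : ℕ → ℕ) (p k : ℕ) : ℕ → ℕ :=
  fun i => if i < p then f i else if i < p + 2 then k else f (i - 2)

section InsertTwo

variable (f : ℕ → ℕ) (p k : ℕ)

lemma insertTwo_of_lt {i : ℕ} (h : i < p) : insertTwo f p k i = f i := by simp [insertTwo, h]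

lemma insertTwo_self : insertTwo f p k p = k := by simp [insertTwo]

lemma insertTwo_self_add_one : insertTwo f p k (p + 1) = k := by simp [insertTwo]

lemma insertTwo_add (i : ℕ) : insertTwo f p k (p + 2 + i) = f (p + i) := by
  have h : p + 2 + i - 2 = p + i := by omega
  simp [insertTwo, h, show ¬ p + 2 + i < p by omega]

lemma insertTwo_cases (P : ℕ → Prop) (hlt : ∀ i < p, P i) (h₀ : P p) (h₁ : P (p + 1))
    (hadd : ∀ i, P (p + 2 + i)) (i : ℕ) : P i := by
  rcases lt_or_ge i p with h | h
  · exact hlt i h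
  · obtain ⟨_ | _ | c, rfl⟩ := Nat.exists_eq_add_of_le h
    · exact h₀
    · exact h₁
    · convert hadd c using 1
      omega

lemma partSum_insertTwo_of_le {n : ℕ} (h : n ≤ p) : partSum (insertTwo f p k) n = partSum f n :=
  Finset.sum_congr rfl fun _ hi =>
    insertTwo_of_lt f p k ((Finset.mem_range.1 hi).trans_le h)

lemma partSum_insertTwo_add (n : ℕ) :
    partSum (insertTwo f p k) (p + 2 + n) = partSum f (p + n) + 2 * k := by
  induction n with
  | zero =>
    rw [add_zero, add_zero, partSum_succ, partSum_succ, partSum_insertTwo_of_le f p k le_rfl,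
      insertTwo_self, insertTwo_self_add_one]
    omega
  | succ n ih =>
    rw [← add_assoc, ← add_assoc, partSum_succ, partSum_succ, ih, insertTwo_add]
    omega

variable {f p k}

lemma orthCollapse_insertTwo (hk : k % 2 = 1) (hlt : ∀ i < p, k ≤ f i) (hle : f p ≤ k) :
    orthCollapse (insertTwo f p k) = insertTwo (orthCollapse f) p k := by
  have hp : defect f p = if (partSum f p + p) % 2 = 1 then 1 else 0 := by
    rcases p with _ | q
    · simp
    · have := hlt q (by omega)
      unfold defect
      rw [Nat.add_sub_cancel]
      congr 1
      rw [eq_iff_iff]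
      omega
  have hd_lt : ∀ n < p, defect (insertTwo f p k) n = defect f n := by
    intro n hn
    rw [defect, defect, partSum_insertTwo_of_le f p k hn.le, insertTwo_of_lt f p k hn,
      insertTwo_of_lt f p k (by omega)]
  have hd_p : defect (insertTwo f p k) p = defect f p := by
    rw [hp, defect, partSum_insertTwo_of_le f p k le_rfl, insertTwo_self]
    simp [hk]
  have hd_p1 : defect (insertTwo f p k) (p + 1) = defect f p := by
    rw [hp, defect_succ, partSum_insertTwo_of_le f p k le_rfl, insertTwo_self,
      insertTwo_self_add_one]
    congr 1
    rw [eq_iff_iff]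
    omega
  have hd_add : ∀ n, defect (insertTwo f p k) (p + 2 + n) = defect f (p + n) := by
    rintro (_ | n)
    · have h := partSum_insertTwo_add f p k 0
      rw [add_zero, add_zero] at h ⊢
      rw [hp, defect, h, show p + 2 - 1 = p + 1 by omega, insertTwo_self_add_one]
      congr 1
      rw [eq_iff_iff]
      omega
    · rw [← add_assoc, ← add_assoc, defect_succ, defect_succ, partSum_insertTwo_add, insertTwo_add,
        add_assoc (p + 2), insertTwo_add, ← add_assoc p]
      congr 1
      rw [eq_iff_iff]
      omega
  have hd_le : ∀ n ≤ p, defect (insertTwo f p k) n = defect f n := fun n hn =>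
    (Nat.lt_or_eq_of_le hn).elim (hd_lt n) fun h => h ▸ hd_p
  funext i
  refine insertTwo_cases p (fun i => orthCollapse (insertTwo f p k) i =
    insertTwo (orthCollapse f) p k i) (fun i hi => ?_) ?_ ?_ (fun i => ?_) i
  · rw [orthCollapse, insertTwo_of_lt f p k hi, insertTwo_of_lt _ p k hi, hd_le i hi.le,
      hd_le (i + 1) hi, orthCollapse]
  · rw [orthCollapse, insertTwo_self, insertTwo_self, hd_p, hd_p1, Nat.add_sub_cancel]
  · have h := hd_add 0
    rw [add_zero, add_zero] at h
    rw [orthCollapse, insertTwo_self_add_one, insertTwo_self_add_one, hd_p1, h,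
      Nat.add_sub_cancel]
  · rw [orthCollapse, insertTwo_add, insertTwo_add, hd_add, add_assoc (p + 2), hd_add,
      orthCollapse, add_assoc]

lemma pmult_insertTwo {N : ℕ} (hN : ∀ j, N ≤ j → f j = 0) {v : ℕ} (hv : 0 < v) :
    pmult (insertTwo f p k) v = pmult f v + pmult (twoParts k) v := by
  have h₁ : ∀ j, p + N ≤ j → f j = 0 := fun j hj => hN j (by omega)
  have h₂ : ∀ j, p + 2 + N ≤ j → insertTwo f p k j = 0 := by
    intro j hj
    obtain ⟨c, rfl⟩ := Nat.exists_eq_add_of_le hj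
    rw [add_assoc, insertTwo_add]
    exact hN _ (by omega)
  have h₃ : ∀ j, 2 ≤ j → twoParts k j = 0 := fun j hj => by
    simp [twoParts, hj.not_gt]
  rw [pmult_eq_sum h₁ hv, pmult_eq_sum h₂ hv, pmult_eq_sum h₃ hv, Finset.sum_range_add,
    Finset.sum_range_add, Finset.sum_range_add _ p N]
  simp only [insertTwo_add]
  rw [Finset.sum_congr rfl fun i hi => by
    rw [insertTwo_of_lt f p k (Finset.mem_range.1 hi)]]
  simp only [Finset.sum_range_succ, Finset.sum_range_zero, add_zero, zero_add, insertTwo_self,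
    insertTwo_self_add_one, twoParts, Nat.zero_lt_two, Nat.one_lt_two, if_true]
  omega

end InsertTwo

section StripTwo

variable {μ : ℕ → ℕ} {k : ℕ}

lemma stripTwo_eq (hμ : Antitone μ) (hstep : μ k + 2 ≤ μ (k - 1)) (j : ℕ) :
    μ j = stripTwo μ k j + if j < k then 2 else 0 := by
  unfold stripTwo
  split_ifs with h
  · have := hμ (show j ≤ k - 1 by omega)
    omega
  · rfl

lemma stripTwo_antitone (hμ : Antitone μ) (hstep : μ k + 2 ≤ μ (k - 1)) :
    Antitone (stripTwo μ k) := by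
  refine antitone_nat_of_succ_le fun n => ?_
  have h := hμ (Nat.le_add_right n 1)
  have h₁ := stripTwo_eq hμ hstep n
  have h₂ := stripTwo_eq hμ hstep (n + 1)
  have h₃ : n + 1 = k → μ (n + 1) + 2 ≤ μ n := by
    rintro rfl
    exact hstep
  split_ifs at h₁ h₂ <;> omega

lemma partSum_stripTwo (hμ : Antitone μ) (hstep : μ k + 2 ≤ μ (k - 1)) (n : ℕ) :
    partSum μ n = partSum (stripTwo μ k) n + 2 * min n k := by
  induction n with
  | zero => simp
  | succ n ih =>
    rw [partSum_succ, partSum_succ, ih, stripTwo_eq hμ hstep n]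
    split_ifs <;> omega

lemma stripTwo_eq_zero {N : ℕ} (hN : ∀ j, N ≤ j → μ j = 0) (j : ℕ) (hj : N ≤ j) :
    stripTwo μ k j = 0 := by
  simp [stripTwo, hN j hj]

lemma IsPartitionOf.stripTwo {m : ℕ} (hμ : IsPartitionOf μ (2 * m))
    (hstep : μ k + 2 ≤ μ (k - 1)) : IsPartitionOf (stripTwo μ k) (2 * (m - k)) := by
  obtain ⟨N, hN, hs⟩ := partSum_eq_of_isPartitionOf hμ
  refine ⟨stripTwo_antitone hμ.1 hstep, N + k,
    fun j hj => stripTwo_eq_zero hN j (by omega), ?_⟩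
  have h := partSum_stripTwo hμ.1 hstep (N + k)
  rw [hs _ (by omega)] at h
  change partSum _ _ = _
  omega

lemma IsOrthogonal.stripTwo (hμ : Antitone μ) {N : ℕ} (hN : ∀ j, N ≤ j → μ j = 0)
    (hstep : μ k + 2 ≤ μ (k - 1)) (ho : IsOrthogonal μ) : IsOrthogonal (stripTwo μ k) := by
  rw [isOrthogonal_iff hμ hN] at ho
  rw [isOrthogonal_iff (stripTwo_antitone hμ hstep) (stripTwo_eq_zero hN)]
  intro n hn
  have h := ho n
  have h₁ := stripTwo_eq hμ hstep n
  have h₂ := stripTwo_eq hμ hstep (n + 1)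
  have h₃ := partSum_stripTwo hμ hstep (n + 1)
  rw [Nat.even_iff] at h ⊢
  split_ifs at h₁ h₂ <;> omega

lemma pmult_ptrans_stripTwo (hμ : Antitone μ) {N : ℕ} (hN : ∀ j, N ≤ j → μ j = 0)
    (hstep : μ k + 2 ≤ μ (k - 1)) {v : ℕ} (hv : 0 < v) :
    pmult (ptrans μ) v = pmult (ptrans (stripTwo μ k)) v + if v = k then 2 else 0 := by
  obtain ⟨v, rfl⟩ := Nat.exists_eq_succ_of_ne_zero hv.ne'
  rw [Nat.succ_eq_add_one]
  have h₁ := pmult_ptrans hμ hN v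
  have h₂ := pmult_ptrans (stripTwo_antitone hμ hstep) (stripTwo_eq_zero hN) v
  have h₃ := stripTwo_eq hμ hstep v
  have h₄ := stripTwo_eq hμ hstep (v + 1)
  split_ifs at * <;> omega

lemma ptrans_eq_insertTwo (hk : 0 < k) (hμ : Antitone μ) {N : ℕ} (hN : ∀ j, N ≤ j → μ j = 0)
    (hstep : μ k + 2 ≤ μ (k - 1)) :
    ptrans μ = insertTwo (ptrans (stripTwo μ k)) (stripTwo μ k (k - 1)) k := by
  have hν := stripTwo_antitone hμ hstep
  have heq := stripTwo_eq hμ hstep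
  have hlow : ∀ j, k ≤ j → stripTwo μ k j ≤ stripTwo μ k (k - 1) := fun j hj => hν (by omega)
  have hlow' : ∀ j, k ≤ j → μ j ≤ stripTwo μ k (k - 1) := fun j hj => by
    have := heq j
    have := hlow j hj
    split_ifs at * <;> omega
  have hhigh : ∀ j, j < k → stripTwo μ k (k - 1) ≤ stripTwo μ k j := fun j hj => hν (by omega)
  funext i
  refine eq_of_forall_lt_iff fun j => ?_
  rw [lt_ptrans_iff hμ hN]
  have h₁ := hlow j
  have h₂ := hlow' j
  have h₃ := hhigh j
  have h₄ := heq j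
  have h₅ := fun i => lt_ptrans_iff hν (stripTwo_eq_zero hN) j i
  unfold insertTwo
  split_ifs at h₄ ⊢ <;> (try rw [h₅]) <;> omega

end StripTwo

/-- `μ` orthogonal partition of `2m`, `k > 0` odd with
`μ_k ≥ μ_{k+1}+2` (1-based).  Let `ν` be `μ` with the first `k` parts decreased by 2.
Then `ν` is an orthogonal partition of `2(m−k)`; if `μ` is special so is `ν`; and if
`σ, τ` are D-collapses of `νᵗ, μᵗ` then `τ = σ ∪ (k,k)`. -/
theorem stmt14 (m k : ℕ) (μ : ℕ → ℕ) (hk : 0 < k) (hko : Odd k)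
    (hμ : IsPartitionOf μ (2*m)) (hμo : IsOrthogonal μ)
    (hstep : μ k + 2 ≤ μ (k-1)) :
    (IsPartitionOf (stripTwo μ k) (2*(m-k)) ∧ IsOrthogonal (stripTwo μ k)) ∧
    (IsSymplectic (ptrans μ) → IsSymplectic (ptrans (stripTwo μ k))) ∧
    ∀ σ τ : ℕ → ℕ,
      IsDCollapse (2*(m-k)) (ptrans (stripTwo μ k)) σ →
      IsDCollapse (2*m) (ptrans μ) τ →
      IsUnionOf τ σ (twoParts k) := by
  have hν := hμ.stripTwo hstep
  obtain ⟨ha, N, hN, -⟩ := id hμ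
  refine ⟨⟨hν, hμo.stripTwo ha hN hstep⟩, fun hs v hv hvo => ?_, fun σ τ hσ hτ => ?_⟩
  · have h := hs v hv hvo
    rw [pmult_ptrans_stripTwo ha hN hstep hv] at h
    rw [Nat.even_iff] at h ⊢
    split_ifs at h <;> omega
  · have hτp := hτ.1
    obtain ⟨-, M, hM, -⟩ := id hσ.1
    refine ⟨hτp.1, ⟨_, hτp.2.choose_spec.1⟩, fun v hv => ?_⟩
    have hτσ : τ = insertTwo σ (stripTwo μ k (k - 1)) k := by
      rw [IsCollapse.unique hτ (orthCollapse_isCollapse hμ.ptrans),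
        IsCollapse.unique hσ (orthCollapse_isCollapse hν.ptrans),
        ptrans_eq_insertTwo hk ha hN hstep]
      have hlt := lt_ptrans_iff hν.1 (stripTwo_eq_zero hN)
      refine orthCollapse_insertTwo (Nat.odd_iff.1 hko) (fun i hi => ?_) ?_
      · have := (hlt (k - 1) i).2 hi
        omega
      · have h₁ := hlt k (stripTwo μ k (k - 1))
        have h₂ := hν.1 (show k - 1 ≤ k by omega)
        omega
    rw [hτσ, pmult_insertTwo hM hv]
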